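/- Let G_1 and G_2 be partially directed graphs on a common finite vertex set V, each strictly acyclic and each satisfying: whenever I→J is a directed edge and J—K is an undirected edge, also I→K is a directed edge. Suppose G_1 and G_2 have the same skeleton and the same minimal complexes (so they are Markov-equivalent chain graphs), and suppose [G_1] and [G_2] are nonempty. Let p be a strictly positive pmf on ∏_{i∈V}𝒳_i (each 𝒳_i finite nonempty) that factorizes according to some DAG D_1 ∈ [G_1]. Then for every configuration v, ∏_{τ∈CC(G_1)} p(v_τ | v_{Pa_{G_1}(τ)}) = ∏_{τ∈CC(G_2)} p(v_τ | v_{Pa_{G_2}(τ)}), where CC(G_ℓ) denotes the chain components of G_ℓ; indeed both products equal p(v). -/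

import Mathlib

open scoped Classical

/-- A partially directed graph on vertex type `V`: directed edges `dir i j` (i→j) and
undirected edges `undir i j` (i—j), with at most one edge between any two vertices. -/
structure PDG (V : Type) where
  dir : V → V → Prop
  undir : V → V → Prop
  undir_symm : ∀ i j, undir i j → undir j i
  undir_irrefl : ∀ i, ¬ undir i i
  dir_irrefl : ∀ i, ¬ dir i i
  not_dir_dir : ∀ i j, dir i j → ¬ dir j i
  not_dir_undir : ∀ i j, dir i j → ¬ undir i j

namespace PDG

variable {V : Type}

/-- Adjacency: joined by some edge. -/
def Adj (G : PDG V) (i j : V) : Prop := G.dir i j ∨ G.dir j i ∨ G.undir i j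

/-- A semi-directed step from `i` to `j`: an undirected edge or a directed edge `i→j`. -/
def SStep (G : PDG V) (i j : V) : Prop := G.dir i j ∨ G.undir i j

/-- Existence of a semi-directed cycle: `f 0, …, f m` with `f 0 = f m`, `m ≥ 2`,
each consecutive pair a semi-directed step, at least one step directed. -/
def HasSemiDirectedCycle (G : PDG V) : Prop :=
  ∃ (m : ℕ) (f : ℕ → V), 2 ≤ m ∧ f 0 = f m ∧
    (∀ i < m, G.SStep (f i) (f (i + 1))) ∧ (∃ i < m, G.dir (f i) (f (i + 1)))

/-- Strictly acyclic: no semi-directed cycle. -/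
def StrictlyAcyclic (G : PDG V) : Prop := ¬ G.HasSemiDirectedCycle

/-- Joined by a path of undirected edges (possibly trivial). -/
def sameChain (G : PDG V) (i j : V) : Prop := Relation.ReflTransGen G.undir i j

/-- The chain component of a vertex. -/
def chainComp (G : PDG V) (i : V) : Set V := {j | G.sameChain i j}

/-- Parents of a vertex set. -/
def Pa (G : PDG V) (D : Set V) : Set V := {i | ∃ d ∈ D, G.dir i d}

/-- Ancestors of a vertex set (directed path, possibly of length 0). -/
def An (G : PDG V) (D : Set V) : Set V := {i | ∃ d ∈ D, Relation.ReflTransGen G.dir i d}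

/-- A DAG: only directed edges, and no directed cycles. -/
def IsDAG (G : PDG V) : Prop :=
  (∀ i j, ¬ G.undir i j) ∧ ∀ i, ¬ Relation.TransGen G.dir i i

/-- Unshielded collider `(i, k, j)`: `i→k ← j` with `i`, `j` distinct and non-adjacent. -/
def UC (G : PDG V) (i k j : V) : Prop :=
  i ≠ j ∧ G.dir i k ∧ G.dir j k ∧ ¬ G.Adj i j

/-- `D ∈ [G]`: `D` is a DAG with the same skeleton as `G`, containing every directed edge
of `G`, all of whose unshielded colliders are unshielded colliders of `G`. -/
def InClass (D G : PDG V) : Prop :=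
  D.IsDAG ∧ (∀ i j, D.Adj i j ↔ G.Adj i j) ∧ (∀ i j, G.dir i j → D.dir i j) ∧
    (∀ i k j, D.UC i k j → G.UC i k j)

/-- `C` is a nonempty set, connected by undirected edges within `C`, receiving a directed
edge from `I` and one from `J`. -/
def ComplexCand (G : PDG V) (I : V) (C : Set V) (J : V) : Prop :=
  C.Nonempty ∧
  (∀ a ∈ C, ∀ b ∈ C,
    Relation.ReflTransGen (fun x y => G.undir x y ∧ x ∈ C ∧ y ∈ C) a b) ∧
  (∃ c ∈ C, G.dir I c) ∧ (∃ c ∈ C, G.dir J c)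

/-- Minimal complex `(I, C, J)` of `G`. -/
def MinimalComplex (G : PDG V) (I : V) (C : Set V) (J : V) : Prop :=
  I ≠ J ∧ ¬ G.Adj I J ∧ (∀ a ∈ C, ∀ b ∈ C, G.sameChain a b) ∧
  G.ComplexCand I C J ∧ ∀ C' ⊂ C, ¬ G.ComplexCand I C' J

/-- Remove all directed edges pointing into `S`. -/
def removeInto (G : PDG V) (S : Set V) : PDG V where
  dir i j := G.dir i j ∧ j ∉ S
  undir := G.undir
  undir_symm := G.undir_symm
  undir_irrefl := G.undir_irrefl
  dir_irrefl i h := G.dir_irrefl i h.1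
  not_dir_dir i j h h' := G.not_dir_dir i j h.1 h'.1
  not_dir_undir i j h h' := G.not_dir_undir i j h.1 h'

/-- Induced subgraph on the vertex set `D` (kept on the same vertex type; edges
outside `D` are discarded). -/
def induce (G : PDG V) (D : Set V) : PDG V where
  dir i j := G.dir i j ∧ i ∈ D ∧ j ∈ D
  undir i j := G.undir i j ∧ i ∈ D ∧ j ∈ D
  undir_symm i j h := ⟨G.undir_symm i j h.1, h.2.2, h.2.1⟩
  undir_irrefl i h := G.undir_irrefl i h.1
  dir_irrefl i h := G.dir_irrefl i h.1
  not_dir_dir i j h h' := G.not_dir_dir i j h.1 h'.1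
  not_dir_undir i j h h' := G.not_dir_undir i j h.1 h'.1

/-- `G(↛X)`: `G` with every directed edge into `X ∩ An_G(Y)` removed. -/
def noInto (G : PDG V) (X Y : Set V) : PDG V := G.removeInto (X ∩ G.An Y)

/-- `RM(G; X, Y)`: the induced subgraph of `G(↛X)` on `An_{G(↛X)}(Y)`. -/
def RM (G : PDG V) (X Y : Set V) : PDG V :=
  (G.noInto X Y).induce ((G.noInto X Y).An Y)

/-- There is a proper semi-directed path from `X` to `Y` starting with an undirected
edge: distinct vertices `f 0 ∈ X, …, f m ∈ Y`, only `f 0` in `X`, each consecutive pair a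
semi-directed step, the first edge undirected. -/
def HasProperUndirStartPath (G : PDG V) (X Y : Set V) : Prop :=
  ∃ (m : ℕ) (f : ℕ → V), 1 ≤ m ∧
    (∀ i ≤ m, ∀ j ≤ m, f i = f j → i = j) ∧
    f 0 ∈ X ∧ f m ∈ Y ∧ (∀ i < m, G.SStep (f i) (f (i + 1))) ∧
    (∀ i, 1 ≤ i → i ≤ m → f i ∉ X) ∧ G.undir (f 0) (f 1)

/-- Membership in the chain decomposition `CD_G(D)`: the nonempty intersections of `D`
with chain components of `G`. -/
def CDmem (G : PDG V) (D S : Set V) : Prop :=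
  S.Nonempty ∧ ∃ i, S = D ∩ G.chainComp i

end PDG

noncomputable section Prob

open PDG

variable {V : Type} [Fintype V] [DecidableEq V] {𝒳 : V → Type} [∀ i, Fintype (𝒳 i)]
  [∀ i, Nonempty (𝒳 i)]

/-- Marginal `p_S(v_S)`: sum of `p` over configurations agreeing with `v` on `S`. -/
def marginal (p : (∀ i, 𝒳 i) → ℝ) (S : Set V) (v : ∀ i, 𝒳 i) : ℝ :=
  ∑ w : ∀ i, 𝒳 i, if ∀ i ∈ S, w i = v i then p w else 0

/-- Conditional `p(v_A | v_S) = p_{A∪S}(v_{A∪S}) / p_S(v_S)`. -/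
def condP (p : (∀ i, 𝒳 i) → ℝ) (A S : Set V) (v : ∀ i, 𝒳 i) : ℝ :=
  marginal p (A ∪ S) v / marginal p S v

/-- A strictly positive pmf. -/
def IsPositivePMF (p : (∀ i, 𝒳 i) → ℝ) : Prop :=
  (∀ v, 0 < p v) ∧ ∑ v : ∀ i, 𝒳 i, p v = 1

/-- `p` factorizes according to the DAG `D`. -/
def FactorizesDAG (p : (∀ i, 𝒳 i) → ℝ) (D : PDG V) : Prop :=
  ∀ v, p v = ∏ i : V, condP p {i} (D.Pa {i}) v

/-- The (finitely many) chain components of `G`. -/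
def chainComponents (G : PDG V) : Finset (Set V) :=
  Finset.univ.image (fun i => G.chainComp i)

/-- The outer chain-graph factorization `∏_τ p(v_τ | v_{Pa_G(τ)})` over chain
components `τ` of `G`. -/
def chainProd (G : PDG V) (p : (∀ i, 𝒳 i) → ℝ) (v : ∀ i, 𝒳 i) : ℝ :=
  ∏ τ ∈ chainComponents G, condP p τ (G.Pa τ) v

/-- The product `∏_j p(v_{D_j} | v_{Pa_G(D_j)})` over the chain decomposition
`CD_G(D) = {D_1,…,D_k}` (empty intersections contribute a factor `1`). -/
def cdProd (G : PDG V) (p : (∀ i, 𝒳 i) → ℝ) (D : Set V) (v : ∀ i, 𝒳 i) : ℝ :=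
  ∏ τ ∈ chainComponents G, condP p (D ∩ τ) (G.Pa (D ∩ τ)) v

/-- The identification formula (g-formula) of Perković's theorem:
`Σ_b ∏_j p(b_j | pa_G(B_j))` where `{B_1,…,B_k} = CD_G(An_{G_{V∖X}}(Y))`,
the sum running over configurations of `B = An_{G_{V∖X}}(Y) ∖ Y`, all other
coordinates (in particular the intervened values on `X` and the values on `Y`)
being fixed by `v`. -/
def gFormula (G : PDG V) (p : (∀ i, 𝒳 i) → ℝ) (X Y : Set V) (v : ∀ i, 𝒳 i) : ℝ :=
  ∑ w : ∀ i, 𝒳 i,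
    if ∀ i, i ∉ (G.induce Xᶜ).An Y \ Y → w i = v i then
      cdProd G p ((G.induce Xᶜ).An Y) w
    else 0

/-- The re-weighting formula `Σ_{v'} p(v) / ∏_j p(x_j | pa_G(X_j))`, where
`{X_1,…,X_m} = CD_G(X ∩ An_G(Y))` and the sum runs over configurations of
`V ∖ (X ∪ Y)`, the coordinates on `X ∪ Y` being fixed by `v`. -/
def rwFormula (G : PDG V) (p : (∀ i, 𝒳 i) → ℝ) (X Y : Set V) (v : ∀ i, 𝒳 i) : ℝ :=
  ∑ w : ∀ i, 𝒳 i,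
    if ∀ i ∈ X ∪ Y, w i = v i then p w / cdProd G p (X ∩ G.An Y) w else 0

/-- The `Y`-marginal of the truncated factorization of `p` with respect to the DAG `D`:
`Σ_{v_{V∖(X∪Y)}} ∏_{i ∈ V∖X} p(v_i | v_{Pa_D(i)})`, the coordinates on `X ∪ Y` being
fixed by `v`. -/
def truncMarg (D : PDG V) (p : (∀ i, 𝒳 i) → ℝ) (X Y : Set V) (v : ∀ i, 𝒳 i) : ℝ :=
  ∑ w : ∀ i, 𝒳 i,
    if ∀ i ∈ X ∪ Y, w i = v i then
      ∏ i ∈ Finset.univ.filter (fun i => i ∉ X), condP p {i} (D.Pa {i}) w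
    else 0

end Prob

section Helpers

open PDG

/-! ### Graph lemmas -/

theorem aux_path_of_rtg {V : Type} {r : V → V → Prop} {a b : V} (h : Relation.ReflTransGen r a b) :
    ∃ (m : ℕ) (f : ℕ → V), f 0 = a ∧ f m = b ∧ ∀ i < m, r (f i) (f (i + 1)) := by
  induction h using Relation.ReflTransGen.head_induction_on with
  | refl => exact ⟨0, fun _ => b, rfl, rfl, fun i hi => absurd hi (Nat.not_lt_zero i)⟩
  | head hac hcb ih =>
    rename_i a c
    obtain ⟨m, f, h0, hm, hf⟩ := ih
    refine ⟨m + 1, fun n => Nat.casesOn n a f, rfl, hm, ?_⟩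
    intro i hi
    cases i with
    | zero => simpa [h0] using hac
    | succ k => exact hf k (by omega)

theorem aux_no_cycle {V : Type} (G : PDG V) (hG : G.StrictlyAcyclic) {i j : V} (h : G.dir i j) :
    ¬ Relation.ReflTransGen G.SStep j i := by
  intro hp
  obtain ⟨m, f, h0, hm, hf⟩ := aux_path_of_rtg hp
  apply hG
  refine ⟨m + 1, fun n => Nat.casesOn n i f, ?_, hm.symm, ?_, 0, by omega, ?_⟩
  · rcases Nat.eq_zero_or_pos m with rfl | hpos
    · exfalso
      have : j = i := h0.symm.trans hm
      subst this
      exact G.dir_irrefl _ h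
    · omega
  · intro k hk
    cases k with
    | zero => left; simpa [h0] using h
    | succ k => exact hf k (by omega)
  · simpa [h0] using h

theorem aux_sameChain_symm {V : Type} (G : PDG V) {i j : V} (h : G.sameChain i j) :
    G.sameChain j i := by
  unfold PDG.sameChain at *
  induction h with
  | refl => exact Relation.ReflTransGen.refl
  | tail _ hbc ih => exact Relation.ReflTransGen.head (G.undir_symm _ _ hbc) ih

theorem aux_sameChain_sstep {V : Type} (G : PDG V) {i j : V} (h : G.sameChain i j) :
    Relation.ReflTransGen G.SStep i j :=
  Relation.ReflTransGen.mono (fun _ _ h => Or.inr h) _ _ h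

theorem aux_chainComp_eq {V : Type} (G : PDG V) (i j : V) :
    G.chainComp j = G.chainComp i ↔ j ∈ G.chainComp i := by
  constructor
  · intro h
    rw [← h]
    exact Relation.ReflTransGen.refl
  · intro h
    have h' : G.sameChain i j := h
    ext k
    constructor
    · intro hk
      exact Relation.ReflTransGen.trans h' hk
    · intro hk
      exact Relation.ReflTransGen.trans (aux_sameChain_symm G h') hk

theorem aux_dir_sstep {V : Type} {D G : PDG V} (hD : D.InClass G) {i j : V} (h : D.dir i j) :
    G.SStep i j := by
  rcases (hD.2.1 i j).1 (Or.inl h) with h' | h' | h'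
  · exact Or.inl h'
  · exact absurd (hD.2.2.1 _ _ h') (D.not_dir_dir _ _ h)
  · exact Or.inr h'

theorem aux_UC_iff_mc {V : Type} (G : PDG V) (i k j : V) :
    G.UC i k j ↔ G.MinimalComplex i {k} j := by
  constructor
  · rintro ⟨hne, h1, h2, hna⟩
    refine ⟨hne, hna, ?_, ⟨⟨k, rfl⟩, ?_, ⟨k, rfl, h1⟩, ⟨k, rfl, h2⟩⟩, ?_⟩
    · rintro a rfl b rfl
      exact Relation.ReflTransGen.refl
    · rintro a rfl b rfl
      exact Relation.ReflTransGen.refl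
    · intro C' hC' hc
      rw [Set.ssubset_singleton_iff] at hC'
      subst hC'
      exact Set.not_nonempty_empty hc.1
  · rintro ⟨hne, hna, _, ⟨_, _, ⟨c, hc, h1⟩, ⟨d, hd, h2⟩⟩, _⟩
    rw [Set.mem_singleton_iff] at hc hd
    subst hc
    subst hd
    exact ⟨hne, h1, h2, hna⟩

theorem aux_UC_class {V : Type} {D G : PDG V} (hD : D.InClass G) (i k j : V) :
    D.UC i k j ↔ G.UC i k j := by
  refine ⟨hD.2.2.2 i k j, ?_⟩
  rintro ⟨hne, h1, h2, hna⟩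
  exact ⟨hne, hD.2.2.1 _ _ h1, hD.2.2.1 _ _ h2, fun h => hna ((hD.2.1 _ _).1 h)⟩

/-- A nonempty finite set has an element of which no other member is a child. -/
theorem aux_sink {V : Type} [Finite V] (D : PDG V) (hD : D.IsDAG) (T : Set V) (hT : T.Nonempty) :
    ∃ s ∈ T, ∀ t ∈ T, ¬ D.dir s t := by
  let r : V → V → Prop := fun a b => Relation.TransGen D.dir b a
  have : IsTrans V r := ⟨fun a b c h1 h2 => Relation.TransGen.trans h2 h1⟩
  have : Std.Irrefl r := ⟨fun a h => hD.2 a h⟩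
  obtain ⟨s, hs, hmin⟩ := (Finite.wellFounded_of_trans_of_irrefl r).has_min T hT
  exact ⟨s, hs, fun t ht h => hmin t ht (Relation.TransGen.single h)⟩

theorem aux_source {V : Type} [Finite V] (D : PDG V) (hD : D.IsDAG) (T : Set V) (hT : T.Nonempty) :
    ∃ s ∈ T, ∀ t ∈ T, ¬ D.dir t s := by
  let r : V → V → Prop := fun a b => Relation.TransGen D.dir a b
  have : IsTrans V r := ⟨fun a b c h1 h2 => Relation.TransGen.trans h1 h2⟩
  have : Std.Irrefl r := ⟨fun a h => hD.2 a h⟩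
  obtain ⟨s, hs, hmin⟩ := (Finite.wellFounded_of_trans_of_irrefl r).has_min T hT
  exact ⟨s, hs, fun t ht h => hmin t ht (Relation.TransGen.single h)⟩

/-- `i` witnesses that the characteristic imset of `D` is `1` at `T`. -/
def auxTop {V : Type} (D : PDG V) (T : Set V) (i : V) : Prop :=
  i ∈ T ∧ ∀ t ∈ T, t ≠ i → D.dir t i

theorem auxTop_unique {V : Type} (D : PDG V) (T : Set V) {i j : V}
    (hi : auxTop D T i) (hj : auxTop D T j) : i = j := by
  by_contra hne
  exact D.not_dir_dir _ _ (hj.2 i hi.1 hne) (hi.2 j hj.1 (Ne.symm hne))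

theorem auxTop_transfer {V : Type} [Finite V] (D E : PDG V) (hE : E.IsDAG)
    (hsk : ∀ i j, D.Adj i j ↔ E.Adj i j) (huc : ∀ i k j, D.UC i k j → E.UC i k j)
    (T : Set V) (h : ∃ i, auxTop D T i) : ∃ i, auxTop E T i := by
  obtain ⟨i, hi, hpa⟩ := h
  obtain ⟨s, hs, hsink⟩ := aux_sink E hE T ⟨i, hi⟩
  refine ⟨s, hs, fun t ht hts => ?_⟩
  have key : E.Adj t s := by
    by_cases hsi : s = i
    · subst hsi
      exact (hsk _ _).1 (Or.inl (hpa t ht hts))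
    by_cases hti : t = i
    · subst hti
      exact (hsk _ _).1 (Or.inr (Or.inl (hpa s hs hsi)))
    by_contra hna
    have : E.UC t i s := huc _ _ _ ⟨hts, hpa t ht hti, hpa s hs hsi, fun h => hna ((hsk _ _).1 h)⟩
    exact hsink i hi this.2.2.1
  rcases key with h | h | h
  · exact h
  · exact absurd h (hsink t ht)
  · exact absurd h (hE.1 _ _)

/-! ### Moebius-type decomposition of set functions -/

theorem aux_moebius {V : Type} [DecidableEq V] (h : Finset V → ℝ) :
    ∃ g : Finset V → ℝ, ∀ S, h S = ∑ T ∈ S.powerset, g T := by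
  let F : ∀ S : Finset V, (∀ T : Finset V, T ⊂ S → ℝ) → ℝ := fun S rec =>
    h S - ∑ T ∈ S.ssubsets.attach, rec T.1 (Finset.mem_ssubsets.1 T.2)
  have wf : WellFounded (fun S T : Finset V => S ⊂ T) := wellFounded_lt
  refine ⟨wf.fix F, fun S => ?_⟩
  have h1 : wf.fix F S = h S - ∑ T ∈ S.ssubsets, wf.fix F T := by
    rw [WellFounded.fix_eq]
    simp only [F]
    congr 1
    exact Finset.sum_attach S.ssubsets (fun T => wf.fix F T)
  have h2 : S.powerset = insert S S.ssubsets := by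
    rw [Finset.ssubsets, Finset.insert_erase (Finset.mem_powerset_self S)]
  rw [h2, Finset.sum_insert (by simp), h1]
  ring

theorem aux_imset {V : Type} [Fintype V] (D : PDG V) (g : Finset V → ℝ) :
    (∑ i : V, (∑ T ∈ (Finset.univ.filter (fun j => j ∈ ({i} ∪ D.Pa {i} : Set V))).powerset, g T
      - ∑ T ∈ (Finset.univ.filter (fun j => j ∈ D.Pa {i})).powerset, g T))
    = ∑ T : Finset V, if ∃ i, auxTop D (T : Set V) i then g T else 0 := by
  have h1 : ∀ i : V, (∑ T ∈ (Finset.univ.filter (fun j => j ∈ ({i} ∪ D.Pa {i} : Set V))).powerset, g T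
      - ∑ T ∈ (Finset.univ.filter (fun j => j ∈ D.Pa {i})).powerset, g T)
      = ∑ T : Finset V, if auxTop D (T : Set V) i then g T else 0 := by
    intro i
    rw [sub_eq_iff_eq_add, ← Finset.sum_filter]
    rw [← Finset.sum_union]
    · apply Finset.sum_congr _ (fun _ _ => rfl)
      ext T
      simp only [Finset.mem_powerset, Finset.mem_union, Finset.mem_filter, Finset.mem_univ,
        true_and, auxTop, Finset.subset_iff, PDG.Pa, Set.mem_union, Set.mem_singleton_iff,
        Set.mem_setOf_eq, exists_eq_left, Finset.mem_coe]
      constructor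
      · intro h
        by_cases hi : i ∈ T
        · exact Or.inl ⟨hi, fun t ht hne => (h ht).resolve_left hne⟩
        · exact Or.inr fun t ht => (h ht).resolve_left (fun e => hi (e ▸ ht))
      · rintro (⟨_, h⟩ | h) t ht
        · by_cases e : t = i
          · exact Or.inl e
          · exact Or.inr (h t ht e)
        · exact Or.inr (h ht)
    · rw [Finset.disjoint_left]
      intro T hT hT'
      simp only [Finset.mem_powerset, Finset.mem_filter, Finset.mem_univ,
        true_and, auxTop, Finset.subset_iff, PDG.Pa, Set.mem_singleton_iff,
        Set.mem_setOf_eq, exists_eq_left, Finset.mem_coe] at hT hT'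
      exact D.dir_irrefl _ (hT' hT.1)
  rw [Finset.sum_congr rfl (fun i _ => h1 i), Finset.sum_comm]
  refine Finset.sum_congr rfl fun T _ => ?_
  split_ifs with hT
  · obtain ⟨i, hi⟩ := hT
    rw [Finset.sum_eq_single i]
    · rw [if_pos hi]
    · intro j _ hj
      rw [if_neg]
      exact fun h => hj (auxTop_unique D _ h hi)
    · intro h
      exact absurd (Finset.mem_univ i) h
  · apply Finset.sum_eq_zero
    intro i _
    rw [if_neg (fun h => hT ⟨i, h⟩)]

/-! ### Marginals -/

section Marg

variable {V : Type} [Fintype V] [DecidableEq V] {𝒳 : V → Type} [∀ i, Fintype (𝒳 i)]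
  [∀ i, Nonempty (𝒳 i)]

theorem aux_marginal_congr (p : (∀ i, 𝒳 i) → ℝ) (S : Set V) {v w : ∀ i, 𝒳 i}
    (h : ∀ i ∈ S, v i = w i) : marginal p S v = marginal p S w := by
  unfold marginal
  refine Finset.sum_congr rfl fun u _ => ?_
  have : (∀ i ∈ S, u i = v i) ↔ (∀ i ∈ S, u i = w i) :=
    forall₂_congr fun i hi => by rw [h i hi]
  simp only [this]

theorem aux_marginal_pos (p : (∀ i, 𝒳 i) → ℝ) (hp : IsPositivePMF p) (S : Set V) (v : ∀ i, 𝒳 i) :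
    0 < marginal p S v := by
  unfold marginal
  apply Finset.sum_pos'
  · intro w _
    split_ifs
    · exact (hp.1 w).le
    · exact le_rfl
  · refine ⟨v, Finset.mem_univ v, ?_⟩
    rw [if_pos (fun _ _ => rfl)]
    exact hp.1 v

theorem aux_marginal_univ (p : (∀ i, 𝒳 i) → ℝ) (v : ∀ i, 𝒳 i) :
    marginal p Set.univ v = p v := by
  unfold marginal
  rw [Finset.sum_eq_single v]
  · simp
  · intro w _ hw
    rw [if_neg]
    exact fun h => hw (funext fun i => h i (Set.mem_univ i))
  · intro h
    exact absurd (Finset.mem_univ v) h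

theorem aux_marginal_sum (p : (∀ i, 𝒳 i) → ℝ) (S : Set V) (i : V) (hi : i ∉ S) (v : ∀ i, 𝒳 i) :
    marginal p S v = ∑ x : 𝒳 i, marginal p (insert i S) (Function.update v i x) := by
  unfold marginal
  rw [Finset.sum_comm]
  refine Finset.sum_congr rfl fun w _ => ?_
  have key : ∀ x : 𝒳 i, (∀ j ∈ insert i S, w j = Function.update v i x j) ↔
      (x = w i ∧ ∀ j ∈ S, w j = v j) := by
    intro x
    rw [Set.forall_mem_insert]
    have h2 : (∀ j ∈ S, w j = Function.update v i x j) ↔ (∀ j ∈ S, w j = v j) :=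
      forall₂_congr fun j hj => by
        have hji : j ≠ i := fun e => hi (e ▸ hj)
        rw [Function.update_of_ne hji]
    rw [h2, Function.update_self, eq_comm]
  simp only [key]
  by_cases h : ∀ j ∈ S, w j = v j
  · rw [if_pos h, Finset.sum_eq_single (w i)]
    · rw [if_pos ⟨rfl, h⟩]
    · intro x _ hx
      rw [if_neg (fun e => hx e.1)]
    · intro h
      exact absurd (Finset.mem_univ _) h
  · rw [if_neg h]
    symm
    apply Finset.sum_eq_zero
    intro x _
    rw [if_neg (fun e => h e.2)]

theorem aux_condP_congr (p : (∀ i, 𝒳 i) → ℝ) (A S : Set V) {v w : ∀ i, 𝒳 i}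
    (h : ∀ i ∈ A ∪ S, v i = w i) : condP p A S v = condP p A S w := by
  unfold condP
  rw [aux_marginal_congr p (A ∪ S) h, aux_marginal_congr p S (fun i hi => h i (Or.inr hi))]

theorem aux_condP_sum (p : (∀ i, 𝒳 i) → ℝ) (hp : IsPositivePMF p) (S : Set V) (i : V)
    (hi : i ∉ S) (v : ∀ i, 𝒳 i) :
    ∑ x : 𝒳 i, condP p {i} S (Function.update v i x) = 1 := by
  have h1 : ∀ x : 𝒳 i, condP p {i} S (Function.update v i x)
      = marginal p (insert i S) (Function.update v i x) / marginal p S v := by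
    intro x
    unfold condP
    rw [Set.singleton_union]
    congr 1
    refine aux_marginal_congr p S fun j hj => ?_
    have hji : j ≠ i := fun e => hi (e ▸ hj)
    exact Function.update_of_ne hji _ _
  simp only [h1]
  rw [← Finset.sum_div, ← aux_marginal_sum p S i hi v]
  exact div_self (aux_marginal_pos p hp S v).ne'

/-- Marginals on ancestral sets. -/
theorem aux_ancestral (p : (∀ i, 𝒳 i) → ℝ) (hp : IsPositivePMF p) (D : PDG V) (hD : D.IsDAG)
    (hf : FactorizesDAG p D) (n : ℕ) : ∀ S : Set V, Sᶜ.ncard = n →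
    (∀ j ∈ S, ∀ k, D.dir k j → k ∈ S) → ∀ v,
    marginal p S v = ∏ j ∈ Finset.univ.filter (fun j => j ∈ S), condP p {j} (D.Pa {j}) v := by
  induction n with
  | zero =>
    intro S hS _ v
    rw [Set.ncard_eq_zero, Set.compl_empty_iff] at hS
    subst hS
    rw [aux_marginal_univ, hf v]
    simp
  | succ n ih =>
    intro S hS hanc v
    have hne : Sᶜ.Nonempty := by
      rw [← Set.ncard_pos]
      omega
    obtain ⟨i, hi, hmin⟩ := aux_source D hD Sᶜ hne
    have hiS : i ∉ S := hi
    have hpar : ∀ k, D.dir k i → k ∈ S := by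
      intro k hk
      by_contra hkS
      exact hmin k hkS hk
    have hcard : (insert i S)ᶜ.ncard = n := by
      have : (insert i S)ᶜ = Sᶜ \ {i} := by
        ext k
        simp [not_or, and_comm]
      rw [this, Set.ncard_diff_singleton_of_mem hi, hS]
      rfl
    have hanc' : ∀ j ∈ insert i S, ∀ k, D.dir k j → k ∈ insert i S := by
      rintro j (rfl | hj) k hk
      · exact Or.inr (hpar k hk)
      · exact Or.inr (hanc j hj k hk)
    have hstep := ih (insert i S) hcard hanc'
    rw [aux_marginal_sum p S i hiS v]
    have hterm : ∀ x : 𝒳 i, marginal p (insert i S) (Function.update v i x)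
        = condP p {i} (D.Pa {i}) (Function.update v i x) *
          ∏ j ∈ Finset.univ.filter (fun j => j ∈ S), condP p {j} (D.Pa {j}) v := by
      intro x
      rw [hstep]
      trans ∏ j ∈ insert i (Finset.univ.filter (fun j => j ∈ S)),
        condP p {j} (D.Pa {j}) (Function.update v i x)
      · exact Finset.prod_congr (by ext k; simp) (fun _ _ => rfl)
      rw [Finset.prod_insert (by simpa using hiS)]
      congr 1
      refine Finset.prod_congr rfl fun j hj => ?_
      have hjS : j ∈ S := by simpa using hj
      apply aux_condP_congr
      intro k hk
      apply Function.update_of_ne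
      rintro rfl
      rcases hk with rfl | ⟨d, rfl, hd⟩
      · exact hiS hjS
      · exact hiS (hanc _ hjS _ hd)
    simp only [hterm]
    rw [← Finset.sum_mul, aux_condP_sum p hp _ i, one_mul]
    rintro ⟨d, rfl, hd⟩
    exact D.dir_irrefl _ hd

/-- Summing out coordinates on which the factor `K` does not depend. -/
theorem aux_sumout (p : (∀ i, 𝒳 i) → ℝ) (τ : Set V) (K : (∀ i, 𝒳 i) → ℝ) (P : Set V)
    (hτ : Disjoint P τ) (R : Finset V) : (∀ i ∈ R, i ∉ τ ∧ i ∉ P) →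
    (∀ i ∈ R, ∀ v x, K (Function.update v i x) = K v) →
    (∀ v, marginal p (τ ∪ (P ∪ ↑R)) v = marginal p (P ∪ ↑R) v * K v) →
    ∀ v, marginal p (τ ∪ P) v = marginal p P v * K v := by
  induction R using Finset.induction_on with
  | empty =>
    intro _ _ h
    simpa using h
  | insert i R hiR ih =>
    intro hR hK h
    apply ih (fun j hj => hR j (Finset.mem_insert_of_mem hj))
      (fun j hj => hK j (Finset.mem_insert_of_mem hj))
    intro v
    obtain ⟨hiτ, hiP⟩ := hR i (Finset.mem_insert_self i R)
    have e1 : (τ ∪ (P ∪ ↑(insert i R)) : Set V) = insert i (τ ∪ (P ∪ ↑R)) := by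
      ext k
      simp only [Set.mem_union, Finset.coe_insert, Set.mem_insert_iff]
      tauto
    have e2 : (P ∪ ↑(insert i R) : Set V) = insert i (P ∪ ↑R) := by
      ext k
      simp only [Set.mem_union, Finset.coe_insert, Set.mem_insert_iff]
      tauto
    rw [e1, e2] at h
    have n2 : i ∉ (P ∪ ↑R : Set V) := by
      rintro (h | h)
      · exact hiP h
      · exact hiR h
    have n1 : i ∉ (τ ∪ (P ∪ ↑R) : Set V) := by
      rintro (h | h)
      · exact hiτ h
      · exact n2 h
    rw [aux_marginal_sum p _ i n1, aux_marginal_sum p _ i n2, Finset.sum_mul]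
    refine Finset.sum_congr rfl fun x _ => ?_
    rw [h, hK i (Finset.mem_insert_self i R)]

theorem aux_component (p : (∀ i, 𝒳 i) → ℝ) (hp : IsPositivePMF p) (D G : PDG V)
    (hG : G.StrictlyAcyclic) (hD : D.InClass G)
    (hf : FactorizesDAG p D) (i₀ : V) (v : ∀ i, 𝒳 i) :
    condP p (G.chainComp i₀) (G.Pa (G.chainComp i₀)) v =
      ∏ j ∈ Finset.univ.filter (fun j => j ∈ G.chainComp i₀), condP p {j} (D.Pa {j}) v := by
  set τ := G.chainComp i₀ with hτdef
  have hchain : ∀ a ∈ τ, ∀ b ∈ τ, Relation.ReflTransGen G.SStep a b := fun a ha b hb =>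
    aux_sameChain_sstep G (Relation.ReflTransGen.trans (aux_sameChain_symm G ha) hb)
  have hout : ∀ a ∈ τ, ∀ b, b ∉ τ → D.dir a b → G.dir a b := by
    intro a ha b hb hab
    rcases aux_dir_sstep hD hab with h | h
    · exact h
    · exact absurd (Relation.ReflTransGen.tail ha h) hb
  have hin : ∀ a ∈ τ, ∀ b, D.dir b a → b ∈ τ ∪ G.Pa τ := by
    intro a ha b hab
    rcases aux_dir_sstep hD hab with h | h
    · exact Or.inr ⟨a, ha, h⟩
    · exact Or.inl (Relation.ReflTransGen.tail ha (G.undir_symm _ _ h))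
  have hmono : ∀ {a b : V}, Relation.ReflTransGen D.dir a b → Relation.ReflTransGen G.SStep a b :=
    fun h => Relation.ReflTransGen.mono (fun _ _ h => aux_dir_sstep hD h) _ _ h
  let A : Set V := D.An τ
  let N : Set V := A \ τ
  have hτA : τ ⊆ A := fun a ha => ⟨a, ha, Relation.ReflTransGen.refl⟩
  have hA : ∀ j ∈ A, ∀ k, D.dir k j → k ∈ A := by
    rintro j ⟨d, hd, hjd⟩ k hk
    exact ⟨d, hd, Relation.ReflTransGen.head hk hjd⟩
  have hN : ∀ j ∈ N, ∀ k, D.dir k j → k ∈ N := by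
    rintro j ⟨hjA, hjτ⟩ k hk
    refine ⟨hA j hjA k hk, fun hkτ => ?_⟩
    obtain ⟨d, hd, hjd⟩ := hjA
    exact aux_no_cycle G hG (hout k hkτ j hjτ hk) ((hmono hjd).trans (hchain d hd k hkτ))
  have hPaτ : Disjoint (G.Pa τ) τ := by
    rw [Set.disjoint_left]
    rintro a ⟨d, hd, had⟩ ha
    exact aux_no_cycle G hG had (hchain d hd a ha)
  have hPaN : G.Pa τ ⊆ N := by
    intro a ha
    refine ⟨?_, Set.disjoint_left.1 hPaτ ha⟩
    obtain ⟨d, hd, had⟩ := ha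
    exact ⟨d, hd, Relation.ReflTransGen.single (hD.2.2.1 _ _ had)⟩
  have hmul : ∀ v, marginal p A v = marginal p N v *
      ∏ j ∈ Finset.univ.filter (fun j => j ∈ τ), condP p {j} (D.Pa {j}) v := by
    intro v
    rw [aux_ancestral p hp D hD.1 hf _ A rfl hA, aux_ancestral p hp D hD.1 hf _ N rfl hN,
      ← Finset.prod_union]
    · apply Finset.prod_congr _ (fun _ _ => rfl)
      ext k
      simp only [Finset.mem_filter, Finset.mem_univ, true_and, Finset.mem_union, N, Set.mem_diff]
      constructor
      · intro h
        by_cases hk : k ∈ τ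
        · exact Or.inr hk
        · exact Or.inl ⟨h, hk⟩
      · rintro (h | h)
        · exact h.1
        · exact hτA h
    · rw [Finset.disjoint_left]
      intro k hk hk'
      simp only [Finset.mem_filter, Finset.mem_univ, true_and, N, Set.mem_diff] at hk hk'
      exact hk.2 hk'
  have hNeq : (G.Pa τ ∪ ↑(Finset.univ.filter (fun j => j ∈ N \ G.Pa τ)) : Set V) = N := by
    ext k
    simp only [Set.mem_union, Finset.coe_filter, Finset.mem_univ, true_and, Set.mem_setOf_eq,
      Set.mem_diff]
    constructor
    · rintro (h | h)
      · exact hPaN h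
      · exact h.1
    · intro h
      by_cases hk : k ∈ G.Pa τ
      · exact Or.inl hk
      · exact Or.inr ⟨h, hk⟩
  have hAeq : τ ∪ N = A := by
    simp only [N]
    exact Set.union_diff_cancel hτA
  have hfin := aux_sumout p τ
    (fun v => ∏ j ∈ Finset.univ.filter (fun j => j ∈ τ), condP p {j} (D.Pa {j}) v)
    (G.Pa τ) hPaτ (Finset.univ.filter (fun j => j ∈ N \ G.Pa τ)) ?_ ?_ ?_ v
  · unfold condP at hfin ⊢
    rw [hfin, mul_div_assoc, mul_comm, div_mul_cancel₀]
    exact (aux_marginal_pos p hp _ v).ne'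
  · intro i hi
    simp only [Finset.mem_filter, Finset.mem_univ, true_and, Set.mem_diff] at hi
    exact ⟨hi.1.2, hi.2⟩
  · intro i hi v x
    simp only [Finset.mem_filter, Finset.mem_univ, true_and, Set.mem_diff] at hi
    refine Finset.prod_congr rfl fun j hj => ?_
    have hjτ : j ∈ τ := by simpa using hj
    apply aux_condP_congr
    intro k hk
    apply Function.update_of_ne
    rintro rfl
    have : k ∈ τ ∪ G.Pa τ := by
      rcases hk with rfl | ⟨d, rfl, hd⟩
      · exact Or.inl hjτ
      · exact hin _ hjτ _ hd
    rcases this with h | h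
    · exact hi.1.2 h
    · exact hi.2 h
  · intro v
    rw [hNeq, hAeq]
    exact hmul v

theorem aux_chainProd (p : (∀ i, 𝒳 i) → ℝ) (hp : IsPositivePMF p) (D G : PDG V)
    (hG : G.StrictlyAcyclic) (hD : D.InClass G)
    (hf : FactorizesDAG p D) (v : ∀ i, 𝒳 i) : chainProd G p v = p v := by
  rw [hf v]
  unfold chainProd chainComponents
  apply Finset.prod_image'
  intro i _
  rw [aux_component p hp D G hG hD hf i v]
  apply Finset.prod_congr _ (fun _ _ => rfl)
  ext j
  simp only [Finset.mem_filter, Finset.mem_univ, true_and]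
  exact (aux_chainComp_eq G i j).symm

/-- The DAG product is a function of the skeleton and the unshielded colliders only. -/
theorem aux_markov_equiv (p : (∀ i, 𝒳 i) → ℝ) (hp : IsPositivePMF p) (D E : PDG V)
    (hD : D.IsDAG) (hE : E.IsDAG)
    (hsk : ∀ i j, D.Adj i j ↔ E.Adj i j) (huc : ∀ i k j, D.UC i k j ↔ E.UC i k j)
    (v : ∀ i, 𝒳 i) :
    ∏ i : V, condP p {i} (D.Pa {i}) v = ∏ i : V, condP p {i} (E.Pa {i}) v := by
  obtain ⟨g, hg⟩ := aux_moebius (fun S : Finset V => Real.log (marginal p (↑S : Set V) v))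
  have hS : ∀ S : Set V, Real.log (marginal p S v)
      = ∑ T ∈ (Finset.univ.filter (fun j => j ∈ S)).powerset, g T := by
    intro S
    rw [← hg]
    simp
  have hlog : ∀ F : PDG V, Real.log (∏ i : V, condP p {i} (F.Pa {i}) v)
      = ∑ T : Finset V, if ∃ i, auxTop F (T : Set V) i then g T else 0 := by
    intro F
    rw [← aux_imset, Real.log_prod]
    · refine Finset.sum_congr rfl fun i _ => ?_
      unfold condP
      rw [Real.log_div (aux_marginal_pos p hp _ v).ne' (aux_marginal_pos p hp _ v).ne', hS, hS]
      congr!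
    · intro i _
      exact (div_pos (aux_marginal_pos p hp _ v) (aux_marginal_pos p hp _ v)).ne'
  have hpos : ∀ F : PDG V, 0 < ∏ i : V, condP p {i} (F.Pa {i}) v := fun F =>
    Finset.prod_pos fun i _ => div_pos (aux_marginal_pos p hp _ v) (aux_marginal_pos p hp _ v)
  apply Real.log_injOn_pos (hpos D) (hpos E)
  rw [hlog, hlog]
  refine Finset.sum_congr rfl fun T _ => ?_
  have : (∃ i, auxTop D (T : Set V) i) ↔ (∃ i, auxTop E (T : Set V) i) :=
    ⟨auxTop_transfer D E hE hsk (fun i k j => (huc i k j).1) _,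
      auxTop_transfer E D hD (fun i j => (hsk i j).symm) (fun i k j => (huc i k j).2) _⟩
  simp only [this]

end Marg

end Helpers

/-- If `G₁`, `G₂` are strictly acyclic partially directed graphs with
`I→J, J—K ⇒ I→K`, sharing the same skeleton and the same minimal complexes (hence
Markov-equivalent chain graphs), with `[G₁]`, `[G₂]` nonempty, and the strictly positive
pmf `p` factorizes according to some `D₁ ∈ [G₁]`, then the outer chain-graph
factorizations of `p` based on `G₁` and on `G₂` agree at every configuration; indeed
both equal `p(v)`. -/
theorem stmt10 {V : Type} [Fintype V] [DecidableEq V]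
    (G₁ G₂ : PDG V)
    (hSA₁ : G₁.StrictlyAcyclic) (hSA₂ : G₂.StrictlyAcyclic)
    (hMeek₁ : ∀ I J K : V, G₁.dir I J → G₁.undir J K → G₁.dir I K)
    (hMeek₂ : ∀ I J K : V, G₂.dir I J → G₂.undir J K → G₂.dir I K)
    (hskel : ∀ i j : V, G₁.Adj i j ↔ G₂.Adj i j)
    (hmc : ∀ (I : V) (C : Set V) (J : V),
      G₁.MinimalComplex I C J ↔ G₂.MinimalComplex I C J)
    (hne₁ : ∃ D : PDG V, D.InClass G₁) (hne₂ : ∃ D : PDG V, D.InClass G₂)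
    (𝒳 : V → Type) [∀ i, Fintype (𝒳 i)] [∀ i, Nonempty (𝒳 i)]
    (p : (∀ i, 𝒳 i) → ℝ) (hp : IsPositivePMF p)
    (D₁ : PDG V) (hD₁ : D₁.InClass G₁) (hfact : FactorizesDAG p D₁) :
    ∀ v : ∀ i, 𝒳 i, chainProd G₁ p v = p v ∧ chainProd G₂ p v = p v := by
  intro v
  refine ⟨aux_chainProd p hp D₁ G₁ hSA₁ hD₁ hfact v, ?_⟩
  obtain ⟨D₂, hD₂⟩ := hne₂
  refine aux_chainProd p hp D₂ G₂ hSA₂ hD₂ ?_ v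
  intro w
  rw [hfact w]
  apply aux_markov_equiv p hp D₁ D₂ hD₁.1 hD₂.1
  · intro i j
    rw [hD₁.2.1, hD₂.2.1, hskel]
  · intro i k j
    rw [aux_UC_class hD₁, aux_UC_class hD₂, aux_UC_iff_mc, aux_UC_iff_mc, hmc]
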